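/- For every bounded measurable probability density f on ℝ and every π ∈ F_∞, the squared weighted distance admits the Parseval expansion ‖f − φ∗π‖_Y² = Σ_{j=0}^∞ ( ∫_ℝ ψ_j(t) φ_{σ²}(t) f(t) dt − η_j ∫_ℝ χ_j(h) φ_{1+σ²}(h) π(h) dh )², where the series on the right converges. -/

import Mathlib

open MeasureTheory Real

/-- Density of the normal distribution `N(0, s2)` with variance `s2`. -/
noncomputable def gauss (s2 t : ℝ) : ℝ :=
  (Real.sqrt (2 * Real.pi * s2))⁻¹ * Real.exp (-t ^ 2 / (2 * s2))

/-- `F_∞`: bounded measurable probability densities on `ℝ`. -/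
def IsBoundedDensity (g : ℝ → ℝ) : Prop :=
  Measurable g ∧ (∀ x, 0 ≤ g x) ∧ (∫ x, g x) = 1 ∧
    ∃ C : ℝ, ∀ᵐ x ∂(volume : Measure ℝ), g x ≤ C

/-- The weighted norm `‖g‖_Y = (∫ g(t)² φ_{σ²}(t) dt)^{1/2}`. -/
noncomputable def ynorm (σ : ℝ) (g : ℝ → ℝ) : ℝ :=
  Real.sqrt (∫ t, g t ^ 2 * gauss (σ ^ 2) t)

/-- The `j`-th probabilist's Hermite polynomial. -/
noncomputable def He (j : ℕ) (t : ℝ) : ℝ :=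
  ∑ l ∈ Finset.range (j / 2 + 1),
    (-1 : ℝ) ^ l * ((Nat.factorial (2 * l) : ℝ) / ((2 : ℝ) ^ l * (Nat.factorial l : ℝ))) *
      (Nat.choose j (2 * l) : ℝ) * t ^ (j - 2 * l)

/-- `ψ_j(t) = He_j(t/σ)/√(j!)`. -/
noncomputable def ψ (σ : ℝ) (j : ℕ) (t : ℝ) : ℝ :=
  He j (t / σ) / Real.sqrt (Nat.factorial j)

/-- `χ_j(x) = He_j(x/√(1+σ²))/√(j!)`. -/
noncomputable def χ (σ : ℝ) (j : ℕ) (x : ℝ) : ℝ :=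
  He j (x / Real.sqrt (1 + σ ^ 2)) / Real.sqrt (Nat.factorial j)

/-- `η_j = (σ²/(1+σ²))^{j/2}`. -/
noncomputable def η (σ : ℝ) (j : ℕ) : ℝ :=
  Real.sqrt (σ ^ 2 / (1 + σ ^ 2)) ^ j

open ProbabilityTheory

/-- The `n`-th probabilist's Hermite polynomial with real coefficients. -/
noncomputable def hermiteReal (n : ℕ) : Polynomial ℝ :=
  (Polynomial.hermite n).map (Int.castRingHom ℝ)

lemma natDegree_hermiteReal (n : ℕ) : (hermiteReal n).natDegree = n := by
  rw [hermiteReal, Polynomial.natDegree_map_eq_of_injective Int.cast_injective,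
    Polynomial.natDegree_hermite]

lemma hermiteReal_zero : hermiteReal 0 = 1 := by
  simp [hermiteReal]

lemma hermiteReal_succ (n : ℕ) :
    hermiteReal (n + 1) = Polynomial.X * hermiteReal n - Polynomial.derivative (hermiteReal n) := by
  simp [hermiteReal, Polynomial.hermite_succ, Polynomial.derivative_map]

lemma derivative_hermiteReal_succ (n : ℕ) :
    Polynomial.derivative (hermiteReal (n + 1)) = ((n : Polynomial ℝ) + 1) * hermiteReal n := by
  induction n with
  | zero => simp [hermiteReal_succ, hermiteReal_zero]
  | succ n ih =>
    rw [hermiteReal_succ (n + 1), Polynomial.derivative_sub, Polynomial.derivative_mul, ih,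
      Polynomial.derivative_mul, hermiteReal_succ n]
    simp only [Polynomial.derivative_X, Polynomial.derivative_add, Polynomial.derivative_natCast,
      Polynomial.derivative_one]
    push_cast
    ring

lemma factorial_two_mul_div (l : ℕ) :
    (Nat.factorial (2 * l) : ℝ) / ((2 : ℝ) ^ l * (Nat.factorial l : ℝ)) =
      (Nat.doubleFactorial (2 * l - 1) : ℝ) := by
  have h : Nat.factorial (2 * l) = (2 ^ l * Nat.factorial l) * Nat.doubleFactorial (2 * l - 1) := by
    cases l with
    | zero => simp
    | succ l =>
      rw [← Nat.doubleFactorial_two_mul, show 2 * (l + 1) = (2 * l + 1) + 1 by ring,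
        Nat.factorial_eq_mul_doubleFactorial]
      simp
  rw [h]
  push_cast
  field_simp

lemma He_eq_eval_hermiteReal (j : ℕ) (t : ℝ) : He j t = (hermiteReal j).eval t := by
  rw [Polynomial.eval_eq_sum_range, natDegree_hermiteReal, He]
  refine Finset.sum_of_injOn (fun l => j - 2 * l) ?_ ?_ ?_ ?_
  · intro a ha b hb hab
    simp only [Finset.coe_range, Set.mem_Iio] at ha hb hab
    omega
  · intro a ha
    simp only [Finset.coe_range, Set.mem_Iio] at ha ⊢
    omega
  · intro k hk hk'
    simp only [Finset.mem_range] at hk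
    have hodd : Odd (j + k) := by
      rw [← Nat.not_even_iff_odd]
      rintro ⟨m, hm⟩
      exact hk' ⟨(j - k) / 2, by simp only [Finset.coe_range, Set.mem_Iio]; omega,
        by dsimp only; omega⟩
    simp [hermiteReal, Polynomial.coeff_hermite_of_odd_add hodd]
  · intro l hl
    simp only [Finset.mem_range] at hl
    have hj : j = 2 * l + (j - 2 * l) := by omega
    have hcoeff := Polynomial.coeff_hermite_explicit l (j - 2 * l)
    rw [← hj, Nat.choose_symm (by omega : 2 * l ≤ j)] at hcoeff
    rw [factorial_two_mul_div, hermiteReal, Polynomial.coeff_map, hcoeff]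
    simp

lemma integrable_eval_gaussianReal (q : Polynomial ℝ) (m : ℝ) (v : NNReal) :
    Integrable (fun x => q.eval x) (gaussianReal m v) := by
  induction q using Polynomial.induction_on' with
  | add p q hp hq =>
    simp_rw [Polynomial.eval_add]
    exact hp.add hq
  | monomial n a =>
    simp only [Polynomial.eval_monomial]
    refine Integrable.const_mul ?_ a
    rcases eq_or_ne n 0 with rfl | hn
    · simp
    · have h := (memLp_id_gaussianReal (μ := m) (v := v) n).integrable_norm_pow hn
      refine h.mono (by fun_prop) (by simp)

lemma memLp_eval_gaussianReal (q : Polynomial ℝ) (m : ℝ) (v : NNReal) :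
    MemLp (fun x => q.eval x) 2 (gaussianReal m v) := by
  rw [memLp_two_iff_integrable_sq (by fun_prop)]
  exact (integrable_eval_gaussianReal (q ^ 2) m v).congr (ae_of_all _ fun x => by simp)

lemma integrable_iff_gaussianReal {v : NNReal} (hv : v ≠ 0) (m : ℝ) (g : ℝ → ℝ) :
    Integrable g (gaussianReal m v) ↔ Integrable (fun x => gaussianPDFReal m v x * g x) := by
  rw [gaussianReal_of_var_ne_zero m hv, integrable_withDensity_iff_integrable_smul'
    (measurable_gaussianPDF m v) (by simp [gaussianPDF_lt_top])]
  simp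

/-- Gaussian integration by parts for polynomials. -/
lemma integral_mul_eval_gaussianReal (q : Polynomial ℝ) :
    ∫ x, x * q.eval x ∂gaussianReal 0 1 = ∫ x, q.derivative.eval x ∂gaussianReal 0 1 := by
  have hint := fun p : Polynomial ℝ =>
    (integrable_iff_gaussianReal one_ne_zero 0 _).1 (integrable_eval_gaussianReal p 0 1)
  have key : ∫ x, gaussianPDFReal 0 1 x * (q.derivative - Polynomial.X * q).eval x = 0 := by
    refine integral_eq_zero_of_hasDerivAt_of_integrable
      (f := fun x => gaussianPDFReal 0 1 x * q.eval x) (fun x => ?_) (hint _) (hint q)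
    have hpdf : HasDerivAt (gaussianPDFReal 0 1) (-x * gaussianPDFReal 0 1 x) x := by
      rw [gaussianPDFReal_def]
      have h := ((((hasDerivAt_id x).sub_const 0).pow 2).neg.div_const
        (2 * ((1 : NNReal) : ℝ))).exp.const_mul (√(2 * Real.pi * ((1 : NNReal) : ℝ)))⁻¹
      refine h.congr_deriv ?_
      simp
      ring
    refine (hpdf.mul (q.hasDerivAt x)).congr_deriv ?_
    simp
    ring
  have h0 : ∫ x, (q.derivative.eval x - x * q.eval x) ∂gaussianReal 0 1 = 0 := by
    rw [integral_gaussianReal_eq_integral_smul one_ne_zero]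
    simpa using key
  rw [integral_sub (integrable_eval_gaussianReal _ _ _)
    ((integrable_eval_gaussianReal (Polynomial.X * q) 0 1).congr
      (ae_of_all _ fun x => by simp))] at h0
  linarith

lemma integral_hermiteReal_mul (n : ℕ) (q : Polynomial ℝ) :
    ∫ x, (hermiteReal n).eval x * q.eval x ∂gaussianReal 0 1 =
      ∫ x, (Polynomial.derivative^[n] q).eval x ∂gaussianReal 0 1 := by
  induction n generalizing q with
  | zero => simp [hermiteReal_zero]
  | succ n ih =>
    have hibp := integral_mul_eval_gaussianReal (hermiteReal n * q)
    have hint := fun p : Polynomial ℝ => integrable_eval_gaussianReal p 0 1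
    rw [Function.iterate_succ_apply, ← ih]
    have h1 : ∀ x, (hermiteReal (n + 1)).eval x * q.eval x =
        (Polynomial.X * (hermiteReal n * q)).eval x -
          ((Polynomial.derivative (hermiteReal n)) * q).eval x := by
      intro x
      rw [hermiteReal_succ]
      simp
      ring
    simp_rw [h1]
    rw [integral_sub (hint _) (hint _)]
    simp only [Polynomial.eval_mul, Polynomial.eval_X] at hibp ⊢
    rw [hibp]
    simp only [Polynomial.derivative_mul, Polynomial.eval_add, Polynomial.eval_mul]
    rw [integral_add (by simpa using hint (Polynomial.derivative (hermiteReal n) * q))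
      (by simpa using hint (hermiteReal n * Polynomial.derivative q))]
    ring

lemma iterate_derivative_hermiteReal (n : ℕ) :
    Polynomial.derivative^[n] (hermiteReal n) = (n.factorial : Polynomial ℝ) := by
  induction n with
  | zero => simp [hermiteReal_zero]
  | succ n ih =>
    rw [Function.iterate_succ_apply, derivative_hermiteReal_succ]
    have : ((n : Polynomial ℝ) + 1) * hermiteReal n = (n + 1) • hermiteReal n := by
      simp [nsmul_eq_mul]
    rw [this, Polynomial.iterate_derivative_smul, ih]
    simp [Nat.factorial_succ]

lemma integral_hermiteReal_mul_hermiteReal (n m : ℕ) :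
    ∫ x, (hermiteReal n).eval x * (hermiteReal m).eval x ∂gaussianReal 0 1 =
      if n = m then (n.factorial : ℝ) else 0 := by
  have hlt : ∀ n m : ℕ, m < n →
      ∫ x, (hermiteReal n).eval x * (hermiteReal m).eval x ∂gaussianReal 0 1 = 0 := by
    intro n m h
    rw [integral_hermiteReal_mul,
      Polynomial.iterate_derivative_eq_zero (by rwa [natDegree_hermiteReal])]
    simp
  split_ifs with h
  · subst h
    rw [integral_hermiteReal_mul, iterate_derivative_hermiteReal]
    simp
  · rcases lt_or_gt_of_ne h with h | h
    · simp_rw [mul_comm ((hermiteReal n).eval _)]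
      exact hlt m n h
    · exact hlt n m h

/-- Mehler's formula: Hermite polynomials are eigenfunctions of the Ornstein-Uhlenbeck semigroup. -/
lemma integral_hermiteReal_mehler {a b : ℝ} (hab : a ^ 2 + b ^ 2 = 1) (x : ℝ) (n : ℕ) :
    ∫ z, (hermiteReal n).eval (a * x + b * z) ∂gaussianReal 0 1 =
      a ^ n * (hermiteReal n).eval x := by
  let L : Polynomial ℝ := Polynomial.C (a * x) + Polynomial.C b * Polynomial.X
  have hL : ∀ (q : Polynomial ℝ) z, (q.comp L).eval z = q.eval (a * x + b * z) := by
    intro q z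
    simp [L]
  have hint : ∀ q : Polynomial ℝ,
      Integrable (fun z => q.eval (a * x + b * z)) (gaussianReal 0 1) := by
    intro q
    simpa only [hL] using integrable_eval_gaussianReal (q.comp L) 0 1
  have hstep : ∀ q : Polynomial ℝ,
      ∫ z, (Polynomial.X * q - Polynomial.derivative q).eval (a * x + b * z) ∂gaussianReal 0 1 =
        a * x * ∫ z, q.eval (a * x + b * z) ∂gaussianReal 0 1 -
          a ^ 2 * ∫ z, (Polynomial.derivative q).eval (a * x + b * z) ∂gaussianReal 0 1 := by
    intro q
    have hibp := integral_mul_eval_gaussianReal (q.comp L)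
    have hd : ∀ z, (Polynomial.derivative (q.comp L)).eval z =
        b * (Polynomial.derivative q).eval (a * x + b * z) := by
      intro z
      rw [Polynomial.derivative_comp, Polynomial.eval_mul, hL]
      simp [L]
    simp_rw [hd, hL, integral_const_mul] at hibp
    have hz : Integrable (fun z => z * q.eval (a * x + b * z)) (gaussianReal 0 1) := by
      have h := integrable_eval_gaussianReal (Polynomial.X * q.comp L) 0 1
      simpa only [Polynomial.eval_mul, Polynomial.eval_X, hL] using h
    have h1 : ∀ z, (Polynomial.X * q - Polynomial.derivative q).eval (a * x + b * z) =
        a * x * q.eval (a * x + b * z) + b * (z * q.eval (a * x + b * z)) -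
          (Polynomial.derivative q).eval (a * x + b * z) := by
      intro z
      simp
      ring
    simp_rw [h1]
    have hadd : Integrable (fun z => a * x * q.eval (a * x + b * z) +
        b * (z * q.eval (a * x + b * z))) (gaussianReal 0 1) :=
      ((hint q).const_mul _).add (hz.const_mul _)
    rw [integral_sub hadd (hint _),
      integral_add ((hint q).const_mul _) (hz.const_mul _), integral_const_mul, integral_const_mul,
      hibp]
    linear_combination
      (∫ z, (Polynomial.derivative q).eval (a * x + b * z) ∂gaussianReal 0 1) * hab
  induction n using Nat.twoStepInduction with
  | zero => simp [hermiteReal_zero]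
  | one =>
    rw [hermiteReal_succ, hstep, hermiteReal_zero]
    simp
  | more n ih0 ih1 =>
    have hd : ∀ y, (Polynomial.derivative (hermiteReal (n + 1))).eval y =
        (n + 1) * (hermiteReal n).eval y := by
      intro y
      rw [derivative_hermiteReal_succ]
      simp
    rw [hermiteReal_succ (n + 1), hstep, ih1]
    simp_rw [hd]
    rw [integral_const_mul, ih0, Polynomial.eval_sub, hd]
    simp
    ring

lemma ae_eq_zero_of_integral_cexp_mul_eq_zero {μ : Measure ℝ} {g : ℝ → ℝ} (hg : Integrable g μ)
    (h : ∀ u : ℝ, ∫ x, Complex.exp (u * x * Complex.I) * (g x : ℂ) ∂μ = 0) : g =ᵐ[μ] 0 := by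
  have hneg : Integrable (fun x => -g x) μ := hg.neg
  have : IsFiniteMeasure (μ.withDensity fun x => ENNReal.ofReal (g x)) :=
    isFiniteMeasure_withDensity_ofReal hg.2
  have : IsFiniteMeasure (μ.withDensity fun x => ENNReal.ofReal (-g x)) :=
    isFiniteMeasure_withDensity_ofReal hneg.2
  have hexp : ∀ (u : ℝ) {r : ℝ → ℝ}, Integrable r μ →
      Integrable (fun x => r x • Complex.exp (u * x * Complex.I)) μ := by
    intro u r hr
    refine hr.mono (hr.1.smul (by fun_prop)) (ae_of_all _ fun x => ?_)
    rw [norm_smul, ← Complex.ofReal_mul, Complex.norm_exp_ofReal_mul_I, mul_one]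
  have hchar : (μ.withDensity fun x => ENNReal.ofReal (g x)) =
      μ.withDensity fun x => ENNReal.ofReal (-g x) := by
    refine Measure.ext_of_charFun ?_
    ext u
    rw [charFun_apply_real, charFun_apply_real,
      integral_withDensity_eq_integral_toReal_smul₀ hg.1.aemeasurable.ennreal_ofReal
        (ae_of_all _ fun _ => ENNReal.ofReal_lt_top),
      integral_withDensity_eq_integral_toReal_smul₀ hneg.1.aemeasurable.ennreal_ofReal
        (ae_of_all _ fun _ => ENNReal.ofReal_lt_top), ← sub_eq_zero]
    have hx : ∀ x, (ENNReal.ofReal (g x)).toReal • Complex.exp (u * x * Complex.I) -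
        (ENNReal.ofReal (-g x)).toReal • Complex.exp (u * x * Complex.I) =
        Complex.exp (u * x * Complex.I) * (g x : ℂ) := by
      intro x
      rw [← sub_smul, ENNReal.toReal_ofReal', ENNReal.toReal_ofReal',
        max_zero_sub_max_neg_zero_eq_self, Complex.real_smul, mul_comm]
    rw [← integral_sub (hexp u (r := fun x => (ENNReal.ofReal (g x)).toReal) hg.real_toNNReal)
      (hexp u (r := fun x => (ENNReal.ofReal (-g x)).toReal) hneg.real_toNNReal)]
    simp_rw [hx]
    exact h u
  rw [withDensity_eq_iff hg.1.aemeasurable.ennreal_ofReal hneg.1.aemeasurable.ennreal_ofReal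
    hg.lintegral_lt_top.ne] at hchar
  filter_upwards [hchar] with x hx
  rcases le_total 0 (g x) with h0 | h0
  · rw [ENNReal.ofReal_of_nonpos (neg_nonpos.2 h0), ENNReal.ofReal_eq_zero] at hx
    exact le_antisymm hx h0
  · rw [ENNReal.ofReal_of_nonpos h0, eq_comm, ENNReal.ofReal_eq_zero] at hx
    exact le_antisymm h0 (neg_nonpos.1 hx)

lemma memLp_exp_mul_gaussianReal (u : ℝ) :
    MemLp (fun x => Real.exp (u * x)) 2 (gaussianReal 0 1) := by
  rw [memLp_two_iff_integrable_sq (by fun_prop)]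
  refine (integrable_exp_mul_gaussianReal (2 * u)).congr (ae_of_all _ fun x => ?_)
  dsimp only
  rw [← Real.exp_nat_mul]
  push_cast
  ring_nf

lemma integrable_exp_abs_mul_gaussianReal {g : ℝ → ℝ} (hg : MemLp g 2 (gaussianReal 0 1))
    (u : ℝ) : Integrable (fun x => Real.exp |u * x| * |g x|) (gaussianReal 0 1) := by
  have h := (memLp_exp_mul_gaussianReal u).add (memLp_exp_mul_gaussianReal (-u))
  refine (h.integrable_mul hg).mono ?_ (ae_of_all _ fun x => ?_)
  · exact (by fun_prop : Measurable fun x : ℝ => Real.exp |u * x|).aestronglyMeasurable.mul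
      hg.1.norm
  · simp only [Pi.mul_apply, Pi.add_apply, norm_mul, Real.norm_eq_abs, abs_abs, Real.abs_exp]
    refine mul_le_mul_of_nonneg_right ?_ (abs_nonneg _)
    refine le_trans ?_ (le_abs_self (Real.exp (u * x) + Real.exp (-u * x)))
    rcases abs_choice (u * x) with hx | hx <;> rw [hx]
    · exact le_add_of_nonneg_right (Real.exp_nonneg _)
    · rw [← neg_mul]
      exact le_add_of_nonneg_left (Real.exp_nonneg _)

/-- Polynomials are complete in `L²` of the standard Gaussian. -/
lemma ae_eq_zero_of_integral_eval_mul_eq_zero {g : ℝ → ℝ} (hg : MemLp g 2 (gaussianReal 0 1))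
    (h : ∀ q : Polynomial ℝ, ∫ x, q.eval x * g x ∂gaussianReal 0 1 = 0) :
    g =ᵐ[gaussianReal 0 1] 0 := by
  refine ae_eq_zero_of_integral_cexp_mul_eq_zero (hg.integrable one_le_two) fun u => ?_
  have hreal : ∀ y : ℝ, HasSum (fun n : ℕ => y ^ n / (n.factorial : ℝ)) (Real.exp y) := by
    intro y
    rw [Real.exp_eq_exp_ℝ]
    exact NormedSpace.expSeries_div_hasSum_exp y
  have hsum := hasSum_integral_of_dominated_convergence (μ := gaussianReal 0 1)
    (F := fun (n : ℕ) (x : ℝ) => (u * x * Complex.I) ^ n / (n.factorial : ℂ) * (g x : ℂ))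
    (f := fun x => Complex.exp (u * x * Complex.I) * (g x : ℂ))
    (fun n x => |u * x| ^ n / (n.factorial : ℝ) * |g x|) ?_ ?_ ?_ ?_ ?_
  · refine hsum.unique ?_
    convert hasSum_zero with n
    have hmom := h (Polynomial.X ^ n)
    have hx : ∀ x : ℝ, (u * x * Complex.I) ^ n / (n.factorial : ℂ) * (g x : ℂ) =
        (u * Complex.I) ^ n / (n.factorial : ℂ) * ((x ^ n * g x : ℝ) : ℂ) := by
      intro x
      push_cast
      ring
    simp_rw [hx]
    rw [integral_const_mul, integral_complex_ofReal]
    simp only [Polynomial.eval_pow, Polynomial.eval_X] at hmom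
    rw [hmom]
    simp
  · intro n
    exact (by fun_prop : Measurable fun x : ℝ =>
      (u * x * Complex.I) ^ n / (n.factorial : ℂ)).aestronglyMeasurable.mul
      (Complex.continuous_ofReal.comp_aestronglyMeasurable hg.1)
  · intro n
    refine ae_of_all _ fun x => ?_
    simp [abs_mul]
  · refine ae_of_all _ fun x => ((hreal |u * x|).mul_right _).summable
  · simp_rw [((hreal |u * _|).mul_right _).tsum_eq]
    exact integrable_exp_abs_mul_gaussianReal hg u
  · refine ae_of_all _ fun x => HasSum.mul_right _ ?_
    rw [Complex.exp_eq_exp_ℂ]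
    exact NormedSpace.expSeries_div_hasSum_exp _

lemma integral_eval_mul_eq_zero_of_hermiteReal {g : ℝ → ℝ} (hg : MemLp g 2 (gaussianReal 0 1))
    (h : ∀ n, ∫ x, (hermiteReal n).eval x * g x ∂gaussianReal 0 1 = 0) (q : Polynomial ℝ) :
    ∫ x, q.eval x * g x ∂gaussianReal 0 1 = 0 := by
  have hint : ∀ q : Polynomial ℝ, Integrable (fun x => q.eval x * g x) (gaussianReal 0 1) :=
    fun q => (memLp_eval_gaussianReal q 0 1).integrable_mul hg
  induction hd : q.natDegree using Nat.strong_induction_on generalizing q with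
  | _ d ih =>
    have hlead : (Polynomial.C q.leadingCoeff * hermiteReal d).natDegree ≤ d :=
      (Polynomial.natDegree_C_mul_le _ _).trans (natDegree_hermiteReal d).le
    set r := q - Polynomial.C q.leadingCoeff * hermiteReal d with hr
    have hmonic : (hermiteReal d).coeff d = 1 := by simp [hermiteReal]
    have hrcoeff : r.coeff d = 0 := by
      rw [hr, Polynomial.coeff_sub, Polynomial.coeff_C_mul, hmonic, Polynomial.leadingCoeff, hd]
      ring
    have hrdeg : r.natDegree ≤ d := (Polynomial.natDegree_sub_le _ _).trans (max_le hd.le hlead)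
    have hrint : ∫ x, r.eval x * g x ∂gaussianReal 0 1 = 0 := by
      rcases hrdeg.lt_or_eq with hlt | heq
      · exact ih _ hlt r rfl
      · have : r = 0 := by
          rw [← Polynomial.leadingCoeff_eq_zero, Polynomial.leadingCoeff, heq, hrcoeff]
        simp [this]
    have hx : ∀ x, q.eval x * g x =
        r.eval x * g x + q.leadingCoeff * ((hermiteReal d).eval x * g x) := by
      intro x
      rw [hr]
      simp
      ring
    simp_rw [hx]
    rw [integral_add (hint r) ((hint _).const_mul _), integral_const_mul, h, hrint]
    simp

/-- Parseval's identity for the Hermite expansion in `L²` of the standard Gaussian. -/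
lemma hasSum_hermiteReal_parseval {g : ℝ → ℝ} (hg : MemLp g 2 (gaussianReal 0 1)) :
    HasSum (fun n : ℕ =>
      (∫ x, (hermiteReal n).eval x / √(n.factorial : ℝ) * g x ∂gaussianReal 0 1) ^ 2)
      (∫ x, g x ^ 2 ∂gaussianReal 0 1) := by
  have hmem : ∀ n : ℕ, MemLp (fun x => (hermiteReal n).eval x / √(n.factorial : ℝ)) 2
      (gaussianReal 0 1) := by
    intro n
    simp_rw [div_eq_inv_mul]
    exact (memLp_eval_gaussianReal (hermiteReal n) 0 1).const_mul _
  let v : ℕ → Lp ℝ 2 (gaussianReal 0 1) := fun n => (hmem n).toLp _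
  have hinner : ∀ {a b : ℝ → ℝ} (ha : MemLp a 2 (gaussianReal 0 1))
      (hb : MemLp b 2 (gaussianReal 0 1)),
      inner ℝ (ha.toLp a) (hb.toLp b) = ∫ x, a x * b x ∂gaussianReal 0 1 := by
    intro a b ha hb
    rw [L2.inner_def]
    refine integral_congr_ae ?_
    filter_upwards [ha.coeFn_toLp, hb.coeFn_toLp] with x h1 h2
    rw [h1, h2]
    simp [mul_comm]
  have hv : Orthonormal ℝ v := by
    rw [orthonormal_iff_ite]
    intro i j
    rw [hinner]
    have hx : ∀ x, (hermiteReal i).eval x / √(i.factorial : ℝ) *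
        ((hermiteReal j).eval x / √(j.factorial : ℝ)) =
        (√(i.factorial : ℝ) * √(j.factorial : ℝ))⁻¹ *
          ((hermiteReal i).eval x * (hermiteReal j).eval x) := by
      intro x
      field_simp
    simp_rw [hx]
    rw [integral_const_mul, integral_hermiteReal_mul_hermiteReal]
    split_ifs with hij
    · subst hij
      rw [Real.mul_self_sqrt (by positivity)]
      exact inv_mul_cancel₀ (by positivity)
    · simp
  have hspan : (Submodule.span ℝ (Set.range v))ᗮ = ⊥ := by
    rw [eq_bot_iff]
    intro w hw
    rw [Submodule.mem_bot]
    rw [Submodule.mem_orthogonal] at hw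
    have hwmem := Lp.memLp w
    have hw0 : (w : ℝ → ℝ) =ᵐ[gaussianReal 0 1] 0 := by
      refine ae_eq_zero_of_integral_eval_mul_eq_zero hwmem
        (integral_eval_mul_eq_zero_of_hermiteReal hwmem fun n => ?_)
      have h := hw (v n) (Submodule.subset_span ⟨n, rfl⟩)
      rw [← Lp.toLp_coeFn w hwmem, hinner] at h
      simp_rw [div_mul_eq_mul_div] at h
      rw [integral_div, div_eq_zero_iff] at h
      exact h.resolve_right (by positivity)
    exact (Lp.eq_zero_iff_ae_eq_zero).2 hw0
  have hsum := (HilbertBasis.mkOfOrthogonalEqBot hv hspan).hasSum_inner_mul_inner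
    (hg.toLp g) (hg.toLp g)
  rw [hinner] at hsum
  simp_rw [← sq] at hsum
  rw [HilbertBasis.coe_mkOfOrthogonalEqBot] at hsum
  have hterm : ∀ n, inner ℝ (hg.toLp g) (v n) * inner ℝ (v n) (hg.toLp g) =
      (∫ x, (hermiteReal n).eval x / √(n.factorial : ℝ) * g x ∂gaussianReal 0 1) ^ 2 := by
    intro n
    rw [real_inner_comm, ← sq, hinner]
  simpa only [hterm] using hsum

lemma gauss_nonneg (v t : ℝ) : 0 ≤ gauss v t := by
  unfold gauss
  positivity

lemma gauss_le {v : ℝ} (hv : 0 ≤ v) (t : ℝ) : gauss v t ≤ (√(2 * π * v))⁻¹ := by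
  unfold gauss
  refine mul_le_of_le_one_right (by positivity) (Real.exp_le_one_iff.2 ?_)
  exact div_nonpos_of_nonpos_of_nonneg (by nlinarith [sq_nonneg t]) (by positivity)

lemma measurable_gauss (v : ℝ) : Measurable (gauss v) := by
  unfold gauss
  fun_prop

lemma gauss_sq_mul {s : ℝ} (hs : 0 < s) (z : ℝ) :
    s * gauss (s ^ 2) (s * z) = gaussianPDFReal 0 1 z := by
  rw [gaussianPDFReal_def, gauss, Real.sqrt_mul (by positivity), Real.sqrt_sq hs.le]
  have hexp : -(s * z) ^ 2 / (2 * s ^ 2) = -(z - 0) ^ 2 / (2 * ((1 : NNReal) : ℝ)) := by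
    simp
    field_simp
  rw [hexp]
  simp
  field_simp

lemma integral_mul_gauss_sub {s : ℝ} (hs : 0 < s) (m : ℝ) (g : ℝ → ℝ) :
    ∫ t, g t * gauss (s ^ 2) (t - m) = ∫ z, g (m + s * z) ∂gaussianReal 0 1 := by
  rw [integral_gaussianReal_eq_integral_smul one_ne_zero,
    ← integral_add_left_eq_self (fun t => g t * gauss (s ^ 2) (t - m)) m]
  simp_rw [add_sub_cancel_left, smul_eq_mul, ← gauss_sq_mul hs, mul_assoc]
  rw [integral_const_mul, Measure.integral_comp_mul_left
    (fun t => gauss (s ^ 2) t * g (m + t)), abs_of_pos (inv_pos.2 hs), smul_eq_mul,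
    mul_inv_cancel_left₀ hs.ne']
  simp_rw [mul_comm]

lemma integrable_mul_gauss_iff {s : ℝ} (hs : 0 < s) (g : ℝ → ℝ) :
    Integrable (fun t => g t * gauss (s ^ 2) t) ↔
      Integrable (fun z => g (s * z)) (gaussianReal 0 1) := by
  rw [integrable_iff_gaussianReal one_ne_zero]
  simp_rw [← gauss_sq_mul hs, mul_assoc]
  rw [integrable_const_mul_iff hs.ne'.isUnit,
    integrable_comp_mul_left_iff (fun t => gauss (s ^ 2) t * g t) hs.ne']
  simp_rw [mul_comm]

lemma gauss_mul_gauss {σ r : ℝ} (hσ : 0 < σ) (hr : 0 < r) (hr2 : r ^ 2 = 1 + σ ^ 2) (t h : ℝ) :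
    gauss (σ ^ 2) t * gauss 1 (t - h) =
      gauss (1 + σ ^ 2) h * gauss ((σ / r) ^ 2) (t - (σ / r) ^ 2 * h) := by
  simp only [gauss]
  rw [← hr2, Real.sqrt_mul (by positivity), Real.sqrt_mul (by positivity) (r ^ 2),
    Real.sqrt_mul (by positivity) ((σ / r) ^ 2), Real.sqrt_sq hσ.le, Real.sqrt_sq hr.le,
    Real.sqrt_sq (by positivity), mul_one, mul_mul_mul_comm _ _ (√(2 * π))⁻¹,
    mul_mul_mul_comm _ _ (√(2 * π) * (σ / r))⁻¹, ← Real.exp_add, ← Real.exp_add]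
  congr 1
  · field_simp
  · congr 1
    field_simp
    have hσ2 : σ ^ 2 = r ^ 2 - 1 := by linarith
    have hσ4 : σ ^ 4 = (r ^ 2 - 1) ^ 2 := by rw [← hσ2]; ring
    ring_nf
    simp only [hσ2, hσ4]
    ring

lemma ψ_mul {σ : ℝ} (hσ : 0 < σ) (j : ℕ) (z : ℝ) :
    ψ σ j (σ * z) = (hermiteReal j).eval z / √(j.factorial : ℝ) := by
  rw [ψ, He_eq_eval_hermiteReal, mul_div_cancel_left₀ _ hσ.ne']

lemma measurable_ψ (σ : ℝ) (j : ℕ) : Measurable (ψ σ j) := by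
  unfold ψ
  simp_rw [He_eq_eval_hermiteReal]
  fun_prop

lemma integrable_ψ_mul_gauss {σ : ℝ} (hσ : 0 < σ) (j : ℕ) :
    Integrable (fun t => ψ σ j t * gauss (σ ^ 2) t) := by
  rw [integrable_mul_gauss_iff hσ]
  simp_rw [ψ_mul hσ]
  exact (integrable_eval_gaussianReal _ _ _).div_const _

/-- The adjoint singular relation between `ψ` and `χ`. -/
lemma integral_ψ_mul_gauss_mul_gauss {σ : ℝ} (hσ : 0 < σ) (j : ℕ) (h : ℝ) :
    ∫ t, ψ σ j t * gauss (σ ^ 2) t * gauss 1 (t - h) =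
      η σ j * (χ σ j h * gauss (1 + σ ^ 2) h) := by
  set r := √(1 + σ ^ 2) with hrdef
  have hr : 0 < r := by positivity
  have hr2 : r ^ 2 = 1 + σ ^ 2 := Real.sq_sqrt (by positivity)
  have ha : √(σ ^ 2 / (1 + σ ^ 2)) = σ / r := by
    rw [Real.sqrt_div (by positivity), Real.sqrt_sq hσ.le]
  have hab : (σ / r) ^ 2 + r⁻¹ ^ 2 = 1 := by
    field_simp
    linarith
  simp_rw [mul_assoc, gauss_mul_gauss hσ hr hr2, mul_left_comm _ (gauss (1 + σ ^ 2) h)]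
  rw [integral_const_mul, integral_mul_gauss_sub (by positivity)]
  have harg : ∀ z, ((σ / r) ^ 2 * h + σ / r * z) / σ = σ / r * (h / r) + r⁻¹ * z := by
    intro z
    field_simp
  simp_rw [ψ, χ, He_eq_eval_hermiteReal, harg]
  rw [integral_div, integral_hermiteReal_mehler hab, η, ha]
  ring

lemma IsBoundedDensity.integrable {g : ℝ → ℝ} (hg : IsBoundedDensity g) : Integrable g := by
  by_contra h
  have h1 := hg.2.2.1
  rw [integral_undef h] at h1
  exact zero_ne_one h1

/-- The convolution of `g` with the standard normal density. -/
noncomputable def gaussConv (g : ℝ → ℝ) (t : ℝ) : ℝ := ∫ h, gauss 1 (t - h) * g h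

lemma measurable_gaussConv {g : ℝ → ℝ} (hg : Measurable g) : Measurable (gaussConv g) := by
  have h : Measurable (Function.uncurry fun t h => gauss 1 (t - h) * g h) :=
    ((measurable_gauss 1).comp (measurable_fst.sub measurable_snd)).mul (hg.comp measurable_snd)
  exact h.stronglyMeasurable.integral_prod_right.measurable

lemma abs_gaussConv_le {g : ℝ → ℝ} (hg : IsBoundedDensity g) (t : ℝ) :
    |gaussConv g t| ≤ (√(2 * π * 1))⁻¹ := by
  have h := norm_integral_le_of_norm_le (f := fun h => gauss 1 (t - h) * g h)
    (hg.integrable.const_mul (√(2 * π * 1))⁻¹) (ae_of_all _ fun x => ?_)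
  · rwa [integral_const_mul, hg.2.2.1, mul_one] at h
  · rw [norm_mul, Real.norm_of_nonneg (gauss_nonneg _ _), Real.norm_of_nonneg (hg.2.1 x)]
    exact mul_le_mul_of_nonneg_right (gauss_le zero_le_one _) (hg.2.1 x)

lemma integral_ψ_mul_gauss_mul_gaussConv {σ : ℝ} (hσ : 0 < σ) (j : ℕ) {g : ℝ → ℝ}
    (hg : IsBoundedDensity g) :
    ∫ t, ψ σ j t * gauss (σ ^ 2) t * gaussConv g t =
      η σ j * ∫ h, χ σ j h * gauss (1 + σ ^ 2) h * g h := by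
  have hint : Integrable (Function.uncurry fun t h =>
      gauss 1 (t - h) * (ψ σ j t * gauss (σ ^ 2) t * g h)) (volume.prod volume) := by
    refine ((integrable_ψ_mul_gauss hσ j).mul_prod hg.integrable).bdd_mul
      (c := (√(2 * π * 1))⁻¹) ?_ (ae_of_all _ fun x => ?_)
    · exact ((measurable_gauss 1).comp (measurable_fst.sub measurable_snd)).aestronglyMeasurable
    · rw [Real.norm_of_nonneg (gauss_nonneg _ _)]
      exact gauss_le zero_le_one _
  have hswap := integral_integral_swap hint
  have h1 : ∀ t, ∫ h, gauss 1 (t - h) * (ψ σ j t * gauss (σ ^ 2) t * g h) =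
      ψ σ j t * gauss (σ ^ 2) t * gaussConv g t := by
    intro t
    simp_rw [mul_left_comm (gauss 1 _)]
    rw [integral_const_mul, gaussConv]
  have h2 : ∀ h, ∫ t, gauss 1 (t - h) * (ψ σ j t * gauss (σ ^ 2) t * g h) =
      η σ j * (χ σ j h * gauss (1 + σ ^ 2) h * g h) := by
    intro h
    simp_rw [mul_comm (gauss 1 _), mul_right_comm _ (g h)]
    rw [integral_mul_const, integral_ψ_mul_gauss_mul_gauss hσ]
    ring
  simp_rw [h1, h2] at hswap
  rw [hswap, integral_const_mul]

lemma memLp_comp_mul_gaussianReal {g : ℝ → ℝ} (hg : Measurable g) {C : ℝ}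
    (hC : ∀ᵐ t ∂(volume : Measure ℝ), |g t| ≤ C) {s : ℝ} (hs : 0 < s) :
    MemLp (fun z => g (s * z)) 2 (gaussianReal 0 1) := by
  refine MemLp.of_bound (hg.comp (measurable_const_mul s)).aestronglyMeasurable C ?_
  refine (gaussianReal_absolutelyContinuous 0 one_ne_zero).ae_le ?_
  refine (Measure.QuasiMeasurePreserving.mk (measurable_const_mul s) ?_).ae hC
  rw [Real.map_volume_mul_left hs.ne']
  exact Measure.smul_absolutelyContinuous

/-- Parseval expansion of the squared weighted distance between `f` and `φ∗π`. -/
theorem parseval_expansion (σ : ℝ) (hσ : 0 < σ) (f p : ℝ → ℝ)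
    (hf : IsBoundedDensity f) (hp : IsBoundedDensity p) :
    Summable (fun j : ℕ =>
      ((∫ t, ψ σ j t * gauss (σ ^ 2) t * f t) -
        η σ j * ∫ h, χ σ j h * gauss (1 + σ ^ 2) h * p h) ^ 2) ∧
    ynorm σ (fun t => f t - ∫ h, gauss 1 (t - h) * p h) ^ 2 =
      ∑' j : ℕ, ((∫ t, ψ σ j t * gauss (σ ^ 2) t * f t) -
        η σ j * ∫ h, χ σ j h * gauss (1 + σ ^ 2) h * p h) ^ 2 := by
  obtain ⟨C, hC⟩ := hf.2.2.2
  have hfC : ∀ᵐ t ∂(volume : Measure ℝ), |f t| ≤ C := by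
    filter_upwards [hC] with t ht
    rwa [abs_of_nonneg (hf.2.1 t)]
  have hdiff : ∀ᵐ t ∂(volume : Measure ℝ), |f t - gaussConv p t| ≤ C + (√(2 * π * 1))⁻¹ := by
    filter_upwards [hfC] with t ht
    exact (abs_sub _ _).trans (add_le_add ht (abs_gaussConv_le hp t))
  have hmeas : Measurable fun t => f t - gaussConv p t := hf.1.sub (measurable_gaussConv hp.1)
  have hsum := hasSum_hermiteReal_parseval (memLp_comp_mul_gaussianReal hmeas hdiff hσ)
  have hnorm : ynorm σ (fun t => f t - gaussConv p t) ^ 2 =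
      ∫ z, (f (σ * z) - gaussConv p (σ * z)) ^ 2 ∂gaussianReal 0 1 := by
    rw [ynorm, Real.sq_sqrt (integral_nonneg fun t => mul_nonneg (sq_nonneg _) (gauss_nonneg _ _))]
    simpa using integral_mul_gauss_sub hσ 0 fun t => (f t - gaussConv p t) ^ 2
  have hcoeff : ∀ j : ℕ,
      ∫ z, (hermiteReal j).eval z / √(j.factorial : ℝ) * (f (σ * z) - gaussConv p (σ * z))
        ∂gaussianReal 0 1 =
      (∫ t, ψ σ j t * gauss (σ ^ 2) t * f t) -
        η σ j * ∫ h, χ σ j h * gauss (1 + σ ^ 2) h * p h := by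
    intro j
    have hcov := integral_mul_gauss_sub hσ 0 fun t => ψ σ j t * (f t - gaussConv p t)
    simp_rw [zero_add, sub_zero, ψ_mul hσ] at hcov
    rw [← hcov, ← integral_ψ_mul_gauss_mul_gaussConv hσ j hp,
      ← integral_sub ((integrable_ψ_mul_gauss hσ j).mul_bdd hf.1.aestronglyMeasurable hfC)
        ((integrable_ψ_mul_gauss hσ j).mul_bdd (measurable_gaussConv hp.1).aestronglyMeasurable
          (ae_of_all _ (abs_gaussConv_le hp)))]
    refine integral_congr_ae (ae_of_all _ fun t => ?_)
    dsimp only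
    ring
  simp_rw [hcoeff] at hsum
  exact ⟨hsum.summable, hnorm.trans hsum.tsum_eq.symm⟩
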